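/- arXiv:0811.3410 — 5 statements merged into one kernel-verified Lean document; each statement's English description precedes it below -/
import Mathlib

section
/- Let B be a ZMod 2-submodule of (Fin N → ZMod 2), and let C and D be doubly even submodules of B (every codeword of C and of D has weight divisible by 4). If finrank C < finrank D, then there exists a codeword d ∈ D with d ∉ C such that the submodule C ⊔ (ZMod 2-span of {d}) is doubly even (every one of its elements has weight divisible by 4) and has finrank equal to finrank C + 1. -/
open Submodule

/-- The Hamming weight of a vector over `ZMod 2`. -/
def wt {N : ℕ} (x : Fin N → ZMod 2) : ℕ :=
  (Finset.univ.filter (fun i => x i ≠ 0)).card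

theorem wt_eq_sum_val {N : ℕ} (x : Fin N → ZMod 2) : wt x = ∑ i, (x i).val := by
  have h : ∀ a : ZMod 2, (if a ≠ 0 then 1 else 0) = a.val := by decide
  rw [wt, Finset.card_filter]
  exact Finset.sum_congr rfl fun i _ => h (x i)

theorem wt_add_add_two_mul_sum_val {N : ℕ} (x y : Fin N → ZMod 2) :
    wt (x + y) + 2 * ∑ i, (x i * y i).val = wt x + wt y := by
  have h : ∀ a b : ZMod 2, (a + b).val + 2 * (a * b).val = a.val + b.val := by decide
  simp only [wt_eq_sum_val, Finset.mul_sum, ← Finset.sum_add_distrib, Pi.add_apply, h]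

theorem two_dvd_sum_val_iff_dotProduct_eq_zero {N : ℕ} (x y : Fin N → ZMod 2) :
    2 ∣ ∑ i, (x i * y i).val ↔ x ⬝ᵥ y = 0 := by
  rw [← ZMod.natCast_eq_zero_iff]
  simp [dotProduct]

theorem four_dvd_wt_add_iff_dotProduct_eq_zero {N : ℕ} {x y : Fin N → ZMod 2}
    (hx : 4 ∣ wt x) (hy : 4 ∣ wt y) : 4 ∣ wt (x + y) ↔ x ⬝ᵥ y = 0 := by
  rw [← two_dvd_sum_val_iff_dotProduct_eq_zero]
  have := wt_add_add_two_mul_sum_val x y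
  omega

/-- A doubly even code is self-orthogonal. -/
theorem dotProduct_eq_zero_of_doublyEven {N : ℕ} {C : Submodule (ZMod 2) (Fin N → ZMod 2)}
    (hC : ∀ x ∈ C, 4 ∣ wt x) {x y : Fin N → ZMod 2} (hx : x ∈ C) (hy : y ∈ C) :
    x ⬝ᵥ y = 0 :=
  (four_dvd_wt_add_iff_dotProduct_eq_zero (hC x hx) (hC y hy)).1 (hC _ (C.add_mem hx hy))

/-- If `D` has larger dimension than `C` and is orthogonal to `C ⊓ D`, then some element of `D`
outside `C` is orthogonal to `C`. -/
theorem exists_mem_notMem_orthogonal {K ι : Type*} [Field K] [Fintype ι]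
    {C D : Submodule K (ι → K)} (hCD : ∀ x ∈ D, ∀ y ∈ C ⊓ D, x ⬝ᵥ y = 0)
    (hrank : Module.finrank K C < Module.finrank K D) :
    ∃ d ∈ D, d ∉ C ∧ ∀ c ∈ C, d ⬝ᵥ c = 0 := by
  by_contra! h
  let φ : D →ₗ[K] Module.Dual K C := (dotProductBilin K K).domRestrict₁₂ D C
  have hker : LinearMap.ker φ ≤ C.comap D.subtype := by
    intro d hd
    by_contra hdC
    obtain ⟨c, hc, hne⟩ := h d d.2 hdC
    exact hne (LinearMap.congr_fun (LinearMap.mem_ker.1 hd) ⟨c, hc⟩)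
  have hrange : LinearMap.range φ ≤ (D.comap C.subtype).dualAnnihilator := by
    rintro _ ⟨d, rfl⟩
    rw [Submodule.mem_dualAnnihilator]
    exact fun c hc => hCD d d.2 c ⟨c.2, hc⟩
  have h₁ := LinearMap.finrank_range_add_finrank_ker φ
  have h₂ := Submodule.finrank_mono hker
  have h₃ := Submodule.finrank_mono hrange
  have h₄ := Subspace.finrank_add_finrank_dualAnnihilator_eq (D.comap C.subtype)
  have h₅ : Module.finrank K (C.comap D.subtype) = Module.finrank K (D.comap C.subtype) := by
    rw [← Submodule.finrank_map_subtype_eq D, ← Submodule.finrank_map_subtype_eq C,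
      Submodule.map_comap_subtype, Submodule.map_comap_subtype, inf_comm]
  omega


/-- If `C` and `D` are doubly even subcodes of `B` with `finrank C < finrank D`, then there
is a codeword `d ∈ D`, `d ∉ C`, such that `C ⊔ span {d}` is doubly even of rank
`finrank C + 1`. -/
theorem doublyEven_extend {N : ℕ} (B C D : Submodule (ZMod 2) (Fin N → ZMod 2))
    (hCB : C ≤ B) (hDB : D ≤ B)
    (hC : ∀ x ∈ C, 4 ∣ wt x) (hD : ∀ x ∈ D, 4 ∣ wt x)
    (hrank : Module.finrank (ZMod 2) C < Module.finrank (ZMod 2) D) :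
    ∃ d ∈ D, d ∉ C ∧
      (∀ x ∈ C ⊔ span (ZMod 2) {d}, 4 ∣ wt x) ∧
      Module.finrank (ZMod 2) ((C ⊔ span (ZMod 2) {d}) : Submodule (ZMod 2) (Fin N → ZMod 2))
        = Module.finrank (ZMod 2) C + 1 := by
  obtain ⟨d, hdD, hdC, hd⟩ := exists_mem_notMem_orthogonal (C := C) (D := D)
    (fun x hx y hy => dotProduct_eq_zero_of_doublyEven hD hx hy.2) hrank
  refine ⟨d, hdD, hdC, fun x hx => ?_, finrank_sup_span_singleton hdC⟩
  obtain ⟨c, hc, e, he, rfl⟩ := mem_sup.1 hx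
  obtain ⟨a, rfl⟩ := mem_span_singleton.1 he
  refine (four_dvd_wt_add_iff_dotProduct_eq_zero (hC c hc) (hD _ (D.smul_mem a hdD))).2 ?_
  rw [dotProduct_smul, dotProduct_comm, hd c hc, smul_zero]
end

section
/- For every i : Fin N and every finite set s : Finset (Fin N), left multiplication by the generator acts on Clifford monomials by Γ_i * g_s = (−1)^{m} • g_{s ∆ {i}}, where m is the number of elements j ∈ s with j < i, and s ∆ {i} is the symmetric difference of s with the singleton {i}. -/
/-- The standard positive-definite quadratic form on `Fin N → ℝ`, `Q x = ∑ i, (x i)^2`. -/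
noncomputable def stdQ (N : ℕ) : QuadraticForm ℝ (Fin N → ℝ) :=
  QuadraticMap.weightedSumSquares ℝ (fun _ : Fin N => (1 : ℝ))

/-- The generator `Γ_i` of the Clifford algebra `Cl(0,N)`. -/
noncomputable def Γ {N : ℕ} (i : Fin N) : CliffordAlgebra (stdQ N) :=
  CliffordAlgebra.ι (stdQ N) (Pi.single i 1)

/-- The Clifford monomial `g_s`: the product of the `Γ_i` for `i ∈ s`, in increasing
order of index. -/
noncomputable def gMon {N : ℕ} (s : Finset (Fin N)) : CliffordAlgebra (stdQ N) :=
  ((s.sort (· ≤ ·)).map Γ).prod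

theorem Γ_mul_self {N : ℕ} (i : Fin N) : Γ i * Γ i = 1 := by
  have hQ : stdQ N (Pi.single i 1) = 1 := by
    simp [stdQ, QuadraticMap.weightedSumSquares_apply, Pi.single_apply]
  rw [Γ, CliffordAlgebra.ι_sq_scalar, hQ, map_one]

theorem Γ_mul_Γ_of_ne {N : ℕ} {i j : Fin N} (h : i ≠ j) : Γ i * Γ j = -(Γ j * Γ i) := by
  refine CliffordAlgebra.ι_mul_ι_comm_of_isOrtho ?_
  simp only [QuadraticMap.IsOrtho, stdQ, QuadraticMap.weightedSumSquares_apply,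
    ← Finset.sum_add_distrib]
  refine Finset.sum_congr rfl fun k _ => ?_
  by_cases hi : k = i
  · subst hi; simp [h]
  · simp [hi]

@[simp]
theorem gMon_empty {N : ℕ} : gMon (∅ : Finset (Fin N)) = 1 := by
  simp [gMon]

theorem gMon_insert_of_lt {N : ℕ} {a : Fin N} {s : Finset (Fin N)} (h : ∀ b ∈ s, a < b) :
    gMon (insert a s) = Γ a * gMon s := by
  rw [gMon, Finset.sort_insert _ (fun b hb => (h b hb).le) fun ha => (h a ha).false,
    List.map_cons, List.prod_cons, gMon]

/-- Left multiplication by a generator acts on Clifford monomials: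
`Γ_i * g_s = (-1)^m • g_{s ∆ {i}}` where `m = #{j ∈ s | j < i}`. -/
theorem gamma_mul_gMon {N : ℕ} (i : Fin N) (s : Finset (Fin N)) :
    Γ i * gMon s
      = ((-1 : ℝ) ^ (s.filter (fun j => j < i)).card) • gMon (symmDiff s {i}) := by
  induction s using Finset.induction_on_min with
  | empty =>
    have hsymm : symmDiff ∅ {i} = ({i} : Finset (Fin N)) := bot_symmDiff _
    simpa [hsymm] using (gMon_insert_of_lt (a := i) (s := ∅) (by simp)).symm
  | insert a s hs ih =>
    have ha : a ∉ s := fun h => (hs a h).false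
    rcases lt_trichotomy i a with hia | rfl | hai
    · have hlt : ∀ b ∈ insert a s, i < b := by
        simpa [hia] using fun b hb => hia.trans (hs b hb)
      have hfilter : (insert a s).filter (fun j => j < i) = ∅ :=
        Finset.filter_eq_empty_iff.2 fun b hb => (hlt b hb).not_gt
      have hsymm : symmDiff (insert a s) {i} = insert i (insert a s) := by
        have hi : i ∉ insert a s := fun h => (hlt i h).false
        ext b
        simp only [Finset.mem_symmDiff, Finset.mem_singleton, Finset.mem_insert] at hi ⊢
        grind
      rw [hfilter, hsymm, gMon_insert_of_lt hlt, Finset.card_empty, pow_zero, one_smul]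
    · have hfilter : (insert i s).filter (fun j => j < i) = ∅ :=
        Finset.filter_eq_empty_iff.2 fun b hb => by
          rcases Finset.mem_insert.1 hb with rfl | hb
          · exact lt_irrefl _
          · exact (hs b hb).not_gt
      have hsymm : symmDiff (insert i s) {i} = s := by
        ext b
        simp only [Finset.mem_symmDiff, Finset.mem_singleton, Finset.mem_insert]
        grind
      rw [hfilter, hsymm, gMon_insert_of_lt hs, ← mul_assoc, Γ_mul_self, one_mul,
        Finset.card_empty, pow_zero, one_smul]
    · have hsymm : symmDiff (insert a s) {i} = insert a (symmDiff s {i}) := by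
        ext b
        simp only [Finset.mem_symmDiff, Finset.mem_singleton, Finset.mem_insert]
        grind
      have hlt : ∀ b ∈ symmDiff s {i}, a < b := fun b hb => by
        rcases Finset.mem_symmDiff.1 hb with ⟨hb, -⟩ | ⟨hb, -⟩
        · exact hs b hb
        · rwa [Finset.mem_singleton.1 hb]
      rw [hsymm, gMon_insert_of_lt hs, gMon_insert_of_lt hlt, ← mul_assoc,
        Γ_mul_Γ_of_ne hai.ne', neg_mul, mul_assoc, ih, Finset.filter_insert, if_pos hai,
        Finset.card_insert_of_notMem fun h => ha (Finset.mem_filter.1 h).1, pow_succ,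
        mul_neg_one, neg_smul, mul_smul_comm]
end

section
/- The family of Clifford monomials (g_s), indexed by all finite sets s : Finset (Fin N), is linearly independent over ℝ in Cl(0,N). -/
namespace CliffordAlgebra

variable {R M : Type*} [CommRing R] [AddCommGroup M] [Module R M]

theorem contractLeft_prod_map_ι_eq_zero (Q : QuadraticForm R M) (d : Module.Dual R M)
    (l : List M) (hd : ∀ m ∈ l, d m = 0) : contractLeft d (l.map (ι Q)).prod = 0 := by
  induction l with
  | nil => simp
  | cons m l ih =>
    simp only [List.forall_mem_cons] at hd
    simp [contractLeft_ι_mul, hd.1, ih hd.2]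

/-- `changeForm` preserves products of pairwise orthogonal vectors. -/
theorem changeForm_prod_map_ι {Q Q' : QuadraticForm R M} {B : LinearMap.BilinForm R M}
    (h : B.toQuadraticMap = Q' - Q) (l : List M) (hl : l.Pairwise fun x y => B x y = 0) :
    changeForm h (l.map (ι Q)).prod = (l.map (ι Q')).prod := by
  induction l with
  | nil => simp
  | cons m l ih =>
    rw [List.pairwise_cons] at hl
    rw [List.map_cons, List.prod_cons, changeForm_ι_mul, ih hl.2,
      contractLeft_prod_map_ι_eq_zero Q' (B m) l hl.1, sub_zero, List.map_cons, List.prod_cons]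

end CliffordAlgebra

theorem Module.Basis.exteriorAlgebra_apply_eq_prod {R M I : Type*} [CommRing R] [AddCommGroup M]
    [Module R M] [LinearOrder I] (b : Module.Basis I R M) (s : Finset I) :
    b.ExteriorAlgebra s =
      (((s.sort (· ≤ ·)).map b).map (ExteriorAlgebra.ι R)).prod := by
  rw [ExteriorAlgebra.basis_apply_ofCard b rfl, ← Finset.listMap_orderEmbOfFin_finRange s rfl]
  simp only [← List.ofFn_eq_map, List.map_ofFn]
  rfl

theorem polar_stdQ_single_of_ne {N : ℕ} {i j : Fin N} (hij : i ≠ j) :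
    QuadraticMap.polar (stdQ N) (Pi.single i 1) (Pi.single j 1) = 0 := by
  simp only [QuadraticMap.polar, stdQ, QuadraticMap.weightedSumSquares_apply, Pi.add_apply,
    ← Finset.sum_sub_distrib, smul_eq_mul, one_mul]
  refine Finset.sum_eq_zero fun k _ => ?_
  by_cases hi : k = i
  · subst hi
    simp [hij]
  · simp [hi]

/-- The Clifford monomials `g_s`, indexed by finsets `s`, are linearly independent
over `ℝ`. -/
theorem gMon_linearIndependent (N : ℕ) :
    LinearIndependent ℝ (fun s : Finset (Fin N) => gMon s) := by
  let b := Pi.basisFun ℝ (Fin N)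
  have key (s : Finset (Fin N)) :
      CliffordAlgebra.equivExterior (stdQ N) (gMon s) = b.ExteriorAlgebra s := by
    have hs : gMon s = (((s.sort (· ≤ ·)).map b).map (CliffordAlgebra.ι (stdQ N))).prod := by
      simp [gMon, b, Function.comp_def, ← Γ.eq_1]
    rw [b.exteriorAlgebra_apply_eq_prod, hs]
    refine CliffordAlgebra.changeForm_prod_map_ι
      CliffordAlgebra.changeForm.associated_neg_proof _ (List.pairwise_map.2 ?_)
    refine (s.sort_nodup (· ≤ ·)).imp fun {i j} hij => ?_
    simp [QuadraticMap.associated_apply, b, ← QuadraticMap.polar.eq_1,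
      polar_stdQ_single_of_ne hij]
  refine LinearIndependent.of_comp (CliffordAlgebra.equivExterior (stdQ N)).toLinearMap ?_
  have hcomp : (CliffordAlgebra.equivExterior (stdQ N)).toLinearMap ∘ (fun s => gMon s) =
      b.ExteriorAlgebra := funext key
  rw [hcomp]
  exact b.ExteriorAlgebra.linearIndependent
end

section
/- Let w : Fin r → (Fin N → ZMod 2) be a linearly independent family of vectors over ZMod 2, and for each i let s_i : Finset (Fin N) be the support of w i (the set of coordinates where w i equals 1). Then the product ∏_{i=0}^{r−1} ((1/2 : ℝ) • (1 + g_{s_i})), taken in the order i = 0, 1, …, r−1 in Cl(0,N), is nonzero. -/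
/-- The support of a vector over `ZMod 2`: the finset of coordinates where it is nonzero. -/
def supp {N : ℕ} (x : Fin N → ZMod 2) : Finset (Fin N) :=
  Finset.univ.filter (fun i => x i ≠ 0)

/-- The sign character `ZMod 2 → ℝ`. -/
noncomputable def zmodTwoSign (c : ZMod 2) : ℝ := if c = 0 then 1 else -1

lemma zmodTwoSign_add (a b : ZMod 2) :
    zmodTwoSign (a + b) = zmodTwoSign a * zmodTwoSign b := by
  have hbit : ∀ a : ZMod 2, a = 0 ∨ a = 1 := by decide
  have htwo : (1 : ZMod 2) + 1 = 0 := by decide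
  rcases hbit a with rfl | rfl <;> rcases hbit b with rfl | rfl <;> simp [zmodTwoSign, htwo]

lemma zmodTwoSign_mul_self (c : ZMod 2) : zmodTwoSign c * zmodTwoSign c = 1 := by
  unfold zmodTwoSign
  split_ifs <;> norm_num

lemma zmodTwoSign_sum {ι : Type*} (s : Finset ι) (f : ι → ZMod 2) :
    zmodTwoSign (∑ i ∈ s, f i) = ∏ i ∈ s, zmodTwoSign (f i) := by
  classical
  induction s using Finset.induction_on with
  | empty => simp [zmodTwoSign]
  | insert a s ha ih => rw [Finset.sum_insert ha, Finset.prod_insert ha, zmodTwoSign_add, ih]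

/-- A linear form on `𝔽₂^N` is the sum of its values at the basis vectors in the support. -/
lemma linearForm_eq_sum_supp {N : ℕ} (φ : (Fin N → ZMod 2) →ₗ[ZMod 2] ZMod 2)
    (x : Fin N → ZMod 2) : φ x = ∑ i ∈ supp x, φ (Pi.single i 1) := by
  rw [φ.pi_apply_eq_sum_univ x, supp, Finset.sum_filter]
  refine Finset.sum_congr rfl fun i _ => ?_
  have hsingle : (fun j => if i = j then (1 : ZMod 2) else 0) = Pi.single i 1 := by
    ext j
    simp [Pi.single_apply, eq_comm]
  rw [hsingle]
  have hx : ∀ c : ZMod 2, c ≠ 0 → c = 1 := by decide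
  split_ifs with h
  · rw [hx _ h, one_smul]
  · rw [not_not.mp h, zero_smul]

/-- Prescribed signs of the coordinates define an isometry of the standard form. -/
noncomputable def signIsometry {N : ℕ} (c : Fin N → ZMod 2) : stdQ N →qᵢ stdQ N where
  toLinearMap := LinearMap.pi fun i => zmodTwoSign (c i) • LinearMap.proj i
  map_app' x := by
    simp only [stdQ, QuadraticMap.weightedSumSquares_apply]
    refine Finset.sum_congr rfl fun i _ => ?_
    simp only [AddHom.toFun_eq_coe, LinearMap.coe_toAddHom, LinearMap.pi_apply,
      LinearMap.smul_apply, LinearMap.proj_apply, smul_eq_mul, one_mul]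
    linear_combination x i * x i * zmodTwoSign_mul_self (c i)

lemma map_signIsometry_Γ {N : ℕ} (c : Fin N → ZMod 2) (i : Fin N) :
    CliffordAlgebra.map (signIsometry c) (Γ i) = zmodTwoSign (c i) • Γ i := by
  rw [Γ, CliffordAlgebra.map_apply_ι, ← map_smul]
  congr 1
  ext j
  change zmodTwoSign (c j) * (Pi.single i 1 : Fin N → ℝ) j = _
  by_cases h : j = i
  · subst h
    simp
  · simp [h]

lemma map_signIsometry_gMon {N : ℕ} (c : Fin N → ZMod 2) (s : Finset (Fin N)) :
    CliffordAlgebra.map (signIsometry c) (gMon s) = (∏ i ∈ s, zmodTwoSign (c i)) • gMon s := by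
  have hlist : ∀ l : List (Fin N), CliffordAlgebra.map (signIsometry c) (l.map Γ).prod =
      (l.map fun i => zmodTwoSign (c i)).prod • (l.map Γ).prod := by
    intro l
    induction l with
    | nil => simp
    | cons a l ih =>
      simp only [List.map_cons, List.prod_cons, map_mul, ih, map_signIsometry_Γ,
        smul_mul_smul_comm]
  rw [gMon, hlist, ← Finset.prod_map_toList s]
  congr 1
  exact ((s.sort_perm_toList (· ≤ ·)).map _).prod_eq

/-- Summing `∏ (1 ± a i) / 2` over all choices of signs gives `1`, so some term is nonzero. -/
lemma exists_signs_prod_ne_zero {A : Type*} [Ring A] [Algebra ℝ A] [Nontrivial A] {r : ℕ}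
    (a : Fin r → A) : ∃ c : Fin r → ZMod 2,
      (List.ofFn fun i => (1 / 2 : ℝ) • (1 + zmodTwoSign (c i) • a i)).prod ≠ 0 := by
  induction r with
  | zero => exact ⟨0, by simp⟩
  | succ r ih =>
    obtain ⟨c, hc⟩ := ih fun i => a i.succ
    by_contra! h
    refine hc ?_
    have h₀ := h (Fin.cons 0 c)
    have h₁ := h (Fin.cons 1 c)
    simp only [List.ofFn_succ, List.prod_cons, Fin.cons_zero, Fin.cons_succ] at h₀ h₁
    have hsum : (1 / 2 : ℝ) • (1 + zmodTwoSign 0 • a 0) +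
        (1 / 2 : ℝ) • (1 + zmodTwoSign 1 • a 0) = 1 := by
      simp only [zmodTwoSign, if_true, one_ne_zero, if_false]
      module
    have hzero := congrArg₂ (· + ·) h₀ h₁
    simpa only [← add_mul, hsum, one_mul, add_zero] using hzero

lemma exists_linearForm_apply_eq {K V ι : Type*} [Field K] [AddCommGroup V] [Module K V]
    {w : ι → V} (hw : LinearIndependent K w) (c : ι → K) :
    ∃ φ : V →ₗ[K] K, ∀ i, φ (w i) = c i := by
  obtain ⟨φ, hφ⟩ := LinearMap.exists_extend ((Module.Basis.span hw).constr K c)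
  refine ⟨φ, fun i => ?_⟩
  have h := LinearMap.congr_fun hφ (Module.Basis.span hw i)
  rw [Module.Basis.constr_basis] at h
  rw [← h, LinearMap.comp_apply, Submodule.subtype_apply, Module.Basis.span_apply]

/-- For a linearly independent family `w` of vectors over `ZMod 2` with supports `s i`,
the ordered product of the projectors `(1 + g_{s i})/2` in `Cl(0,N)` is nonzero. -/
theorem prod_projectors_ne_zero {N r : ℕ} (w : Fin r → (Fin N → ZMod 2))
    (hw : LinearIndependent (ZMod 2) w) :
    (List.ofFn (fun i : Fin r =>
        (1 / 2 : ℝ) • ((1 : CliffordAlgebra (stdQ N)) + gMon (supp (w i))))).prod ≠ 0 := by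
  intro h
  obtain ⟨c, hc⟩ := exists_signs_prod_ne_zero fun i : Fin r => gMon (supp (w i))
  obtain ⟨φ, hφ⟩ := exists_linearForm_apply_eq hw c
  refine hc ?_
  have himage := congrArg
    (CliffordAlgebra.map (signIsometry fun i => φ (Pi.single i 1))) h
  rw [map_zero, map_list_prod, List.map_ofFn] at himage
  rw [← himage]
  congr 2
  funext i
  rw [Function.comp_apply, map_smul, map_add, map_one, map_signIsometry_gMon,
    ← zmodTwoSign_sum, ← linearForm_eq_sum_supp, hφ]
end

section
/- For every N : ℕ, write N = 8m + s with 0 ≤ s ≤ 7. Then the maximum dimension of a doubly even code of length N is k_max(N) = 4m + t(s), where t(0)=t(1)=t(2)=t(3)=0, t(4)=t(5)=1, t(6)=2, t(7)=3. Precisely, k_max(N) is the greatest element of the set of natural numbers k such that there exists a ZMod 2-submodule C of (Fin N → ZMod 2) with finrank C = k and every codeword of C having weight divisible by 4 (this set is nonempty since the zero code has k = 0). -/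
/-- The correction term `t s` for the residue `s = N % 8`. -/
def tcorr : ℕ → ℕ
  | 0 => 0 | 1 => 0 | 2 => 0 | 3 => 0
  | 4 => 1 | 5 => 1 | 6 => 2 | _ => 3

open Matrix

/-- `HasDoublyEven N k` says that there is a doubly even code of length `N` and dimension `k`. -/
def HasDoublyEven (N k : ℕ) : Prop :=
  ∃ C : Submodule (ZMod 2) (Fin N → ZMod 2), Module.finrank (ZMod 2) C = k ∧ ∀ x ∈ C, 4 ∣ wt x

theorem wt_append {N N' : ℕ} (x : Fin N → ZMod 2) (y : Fin N' → ZMod 2) :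
    wt (Fin.append x y) = wt x + wt y := by
  simp only [wt, Finset.card_filter, Fin.sum_univ_add, Fin.append_left, Fin.append_right]

theorem HasDoublyEven.add {N N' k k' : ℕ} (h : HasDoublyEven N k) (h' : HasDoublyEven N' k') :
    HasDoublyEven (N + N') (k + k') := by
  obtain ⟨C, hC, hw⟩ := h
  obtain ⟨C', hC', hw'⟩ := h'
  let e : ((Fin N → ZMod 2) × (Fin N' → ZMod 2)) →ₗ[ZMod 2] (Fin (N + N') → ZMod 2) :=
    { toFun := fun p => Fin.append p.1 p.2
      map_add' := fun p q => by
        ext i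
        refine Fin.addCases (fun j => ?_) (fun j => ?_) i <;> simp
      map_smul' := fun a p => by
        ext i
        refine Fin.addCases (fun j => ?_) (fun j => ?_) i <;> simp }
  have he : Function.Injective e := fun p q hpq => by
    refine Prod.ext (funext fun i => ?_) (funext fun i => ?_)
    · simpa [e] using congrFun hpq (Fin.castAdd N' i)
    · simpa [e] using congrFun hpq (Fin.natAdd N i)
  let eC : C.prod C' ≃ₗ[ZMod 2] C × C' :=
    { Equiv.Set.prod (C : Set (Fin N → ZMod 2)) (C' : Set (Fin N' → ZMod 2)) with
      map_add' := fun _ _ => rfl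
      map_smul' := fun _ _ => rfl }
  refine ⟨(C.prod C').map e, ?_, ?_⟩
  · rw [← (Submodule.equivMapOfInjective e he _).finrank_eq, eC.finrank_eq,
      Module.finrank_prod, hC, hC']
  · rintro _ ⟨p, hp, rfl⟩
    exact wt_append p.1 p.2 ▸ dvd_add (hw _ hp.1) (hw' _ hp.2)

theorem hasDoublyEven_of_matrix {N k : ℕ} (M : Matrix (Fin k) (Fin N) (ZMod 2))
    (hM : ∀ v, v ᵥ* M = 0 → v = 0) (hw : ∀ v, 4 ∣ wt (v ᵥ* M)) : HasDoublyEven N k := by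
  refine ⟨LinearMap.range M.vecMulLinear, ?_, ?_⟩
  · rw [LinearMap.finrank_range_of_inj, Module.finrank_fin_fun]
    exact (injective_iff_map_eq_zero _).2 hM
  · rintro _ ⟨v, rfl⟩
    exact hw v

theorem hasDoublyEven_zero (N : ℕ) : HasDoublyEven N 0 :=
  ⟨⊥, finrank_bot _ _, fun x hx => by simp [(Submodule.mem_bot _).1 hx, wt]⟩

theorem hasDoublyEven_four : HasDoublyEven 4 1 :=
  hasDoublyEven_of_matrix !![1, 1, 1, 1] (by decide) (by decide)

theorem hasDoublyEven_six : HasDoublyEven 6 2 :=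
  hasDoublyEven_of_matrix !![1, 1, 1, 1, 0, 0; 0, 0, 1, 1, 1, 1] (by decide) (by decide)

set_option maxRecDepth 10000 in
theorem hasDoublyEven_seven : HasDoublyEven 7 3 :=
  hasDoublyEven_of_matrix !![1, 0, 0, 0, 1, 1, 1; 0, 1, 0, 1, 0, 1, 1; 0, 0, 1, 1, 1, 0, 1]
    (by decide) (by decide)

set_option maxRecDepth 10000 in
theorem hasDoublyEven_eight : HasDoublyEven 8 4 :=
  hasDoublyEven_of_matrix !![1, 0, 0, 0, 0, 1, 1, 1; 0, 1, 0, 0, 1, 0, 1, 1;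
    0, 0, 1, 0, 1, 1, 0, 1; 0, 0, 0, 1, 1, 1, 1, 0] (by decide) (by decide)

theorem hasDoublyEven_eight_mul (m : ℕ) : HasDoublyEven (8 * m) (4 * m) := by
  induction m with
  | zero => exact hasDoublyEven_zero 0
  | succ m ih => exact ih.add hasDoublyEven_eight

theorem hasDoublyEven_tcorr {s : ℕ} (hs : s < 8) : HasDoublyEven s (tcorr s) := by
  interval_cases s
  · exact hasDoublyEven_zero 0
  · exact hasDoublyEven_zero 1
  · exact hasDoublyEven_zero 2
  · exact hasDoublyEven_zero 3
  · exact hasDoublyEven_four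
  · exact hasDoublyEven_four.add (hasDoublyEven_zero 1)
  · exact hasDoublyEven_six
  · exact hasDoublyEven_seven

open Complex in
theorem I_pow_wt {N : ℕ} (x : Fin N → ZMod 2) :
    I ^ wt x = ∏ i, if x i ≠ 0 then I else 1 := by
  rw [Finset.prod_ite, Finset.prod_const, Finset.prod_const_one, mul_one, wt]

open Complex in
theorem sum_I_pow_wt (N : ℕ) : ∑ x : Fin N → ZMod 2, I ^ wt x = (1 + I) ^ N := by
  have h : ∑ a : ZMod 2, (if a ≠ 0 then I else 1) = 1 + I := by
    rw [show (Finset.univ : Finset (ZMod 2)) = {0, 1} from rfl]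
    simp
  simp_rw [I_pow_wt]
  rw [← Fintype.prod_sum (fun (_ : Fin N) (a : ZMod 2) => if a ≠ 0 then I else 1), h]
  simp

/-- The nontrivial additive character of `ZMod 2`. -/
noncomputable def signChar : AddChar (ZMod 2) ℂ := AddChar.zmodChar 2 (ζ := -1) (by norm_num)

theorem signChar_one : signChar 1 = -1 := by
  simp [signChar, AddChar.zmodChar_apply, ZMod.val_one]

theorem signChar_eq_one_iff (a : ZMod 2) : signChar a = 1 ↔ a = 0 := by
  fin_cases a
  · exact iff_of_true (AddChar.map_zero_eq_one _) rfl
  · change signChar 1 = 1 ↔ (1 : ZMod 2) = 0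
    rw [signChar_one]
    norm_num

open Complex in
/-- The map `x ↦ I ^ wt x` is quadratic with polar form the sign of the dot product. -/
theorem I_pow_wt_add {N : ℕ} (x y : Fin N → ZMod 2) :
    I ^ wt (x + y) = I ^ wt x * I ^ wt y * signChar (x ⬝ᵥ y) := by
  have hsum : signChar (x ⬝ᵥ y) = ∏ i, signChar (x i * y i) :=
    map_prod signChar.toMonoidHom (fun i => Multiplicative.ofAdd (x i * y i)) Finset.univ
  rw [hsum]
  simp_rw [I_pow_wt]
  rw [← Finset.prod_mul_distrib, ← Finset.prod_mul_distrib]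
  refine Finset.prod_congr rfl fun i _ => ?_
  rw [Pi.add_apply]
  generalize x i = a
  generalize y i = b
  have h11 : (1 : ZMod 2) + 1 = 0 := rfl
  have hcases : ∀ c : ZMod 2, c = 0 ∨ c = 1 := by decide
  rcases hcases a with rfl | rfl <;> rcases hcases b with rfl | rfl <;>
    simp [signChar_one, h11]

/-- The dual code. -/
def dualCode {N : ℕ} (C : Submodule (ZMod 2) (Fin N → ZMod 2)) :
    Submodule (ZMod 2) (Fin N → ZMod 2) :=
  LinearMap.BilinForm.orthogonal (dotProductBilin (ZMod 2) (ZMod 2)) C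

theorem mem_dualCode {N : ℕ} {C : Submodule (ZMod 2) (Fin N → ZMod 2)} {x : Fin N → ZMod 2} :
    x ∈ dualCode C ↔ ∀ c ∈ C, c ⬝ᵥ x = 0 :=
  Iff.rfl

theorem finrank_dualCode {N : ℕ} (C : Submodule (ZMod 2) (Fin N → ZMod 2)) :
    Module.finrank (ZMod 2) (dualCode C) = N - Module.finrank (ZMod 2) C := by
  rw [dualCode, LinearMap.BilinForm.finrank_orthogonal, Module.finrank_fin_fun]
  refine ⟨fun x hx => dotProduct_eq_zero x hx, fun x hx => dotProduct_eq_zero x fun w => ?_⟩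
  rw [dotProduct_comm]
  exact hx w

section DoublyEven

variable {N : ℕ} {C : Submodule (ZMod 2) (Fin N → ZMod 2)}

open Complex in
theorem I_pow_wt_eq_one (hC : ∀ x ∈ C, 4 ∣ wt x) {x : Fin N → ZMod 2} (hx : x ∈ C) :
    I ^ wt x = 1 := by
  obtain ⟨n, hn⟩ := hC x hx
  rw [hn, pow_mul, I_pow_four, one_pow]

theorem le_dualCode (hC : ∀ x ∈ C, 4 ∣ wt x) : C ≤ dualCode C := by
  intro x hx c hc
  have h := I_pow_wt_add c x
  rw [I_pow_wt_eq_one hC hc, I_pow_wt_eq_one hC hx, I_pow_wt_eq_one hC (C.add_mem hc hx)] at h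
  rw [one_mul, one_mul] at h
  exact (signChar_eq_one_iff _).1 h.symm

open scoped Classical in
theorem sum_signChar_dotProduct (C : Submodule (ZMod 2) (Fin N → ZMod 2)) (x : Fin N → ZMod 2) :
    ∑ c : C, signChar (x ⬝ᵥ (c : Fin N → ZMod 2)) =
      if x ∈ dualCode C then (Fintype.card C : ℂ) else 0 := by
  let f : C →+ ZMod 2 := ((dotProductBilin (ZMod 2) (ZMod 2) x).comp C.subtype).toAddMonoidHom
  have h := AddChar.sum_eq_ite (signChar.compAddMonoidHom f)
  have hf : signChar.compAddMonoidHom f = 0 ↔ x ∈ dualCode C := by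
    rw [DFunLike.ext_iff, mem_dualCode, Subtype.forall]
    refine forall₂_congr fun c hc => ?_
    rw [dotProduct_comm c x]
    exact signChar_eq_one_iff _
  simp only [hf] at h
  exact h

open Complex in
open scoped Classical in
/-- The Gauss sum of the quadratic function `x ↦ I ^ wt x` is concentrated on the dual code. -/
theorem sum_dualCode_I_pow_wt (hC : ∀ x ∈ C, 4 ∣ wt x) :
    ∑ x : Fin N → ZMod 2, (if x ∈ dualCode C then I ^ wt x else 0) = (1 + I) ^ N := by
  have hcard : (Fintype.card C : ℂ) ≠ 0 := Nat.cast_ne_zero.2 Fintype.card_ne_zero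
  refine mul_left_cancel₀ hcard ?_
  calc (Fintype.card C : ℂ) * ∑ x : Fin N → ZMod 2, (if x ∈ dualCode C then I ^ wt x else 0)
      = ∑ x : Fin N → ZMod 2, ∑ c : C, I ^ wt (x + (c : Fin N → ZMod 2)) := by
        rw [Finset.mul_sum]
        refine Finset.sum_congr rfl fun x _ => ?_
        simp_rw [I_pow_wt_add, I_pow_wt_eq_one hC (Subtype.prop _), mul_one]
        rw [← Finset.mul_sum, sum_signChar_dotProduct]
        split_ifs <;> ring
    _ = ∑ c : C, ∑ x : Fin N → ZMod 2, I ^ wt x := by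
        rw [Finset.sum_comm]
        exact Finset.sum_congr rfl fun c _ =>
          Equiv.sum_comp (Equiv.addRight (c : Fin N → ZMod 2)) fun x => I ^ wt x
    _ = (Fintype.card C : ℂ) * (1 + I) ^ N := by
        rw [sum_I_pow_wt, Finset.sum_const, Finset.card_univ, nsmul_eq_mul]

open Complex in
open scoped Classical in
theorem sum_code_I_pow_wt (hC : ∀ x ∈ C, 4 ∣ wt x) :
    ∑ x : Fin N → ZMod 2, (if x ∈ C then I ^ wt x else 0) =
      2 ^ Module.finrank (ZMod 2) C := by
  have h : Fintype.card C = 2 ^ Module.finrank (ZMod 2) C := by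
    rw [Module.card_eq_pow_finrank (K := ZMod 2), ZMod.card]
  calc ∑ x : Fin N → ZMod 2, (if x ∈ C then I ^ wt x else 0)
      = ∑ x : Fin N → ZMod 2, if x ∈ C then (1 : ℂ) else 0 :=
        Finset.sum_congr rfl fun x _ => by
          split_ifs with hx
          exacts [I_pow_wt_eq_one hC hx, rfl]
    _ = (Fintype.card C : ℂ) := by
        rw [Finset.sum_boole, Fintype.card_subtype]
    _ = _ := by rw [h]; push_cast; rfl

theorem two_mul_finrank_le (hC : ∀ x ∈ C, 4 ∣ wt x) : 2 * Module.finrank (ZMod 2) C ≤ N := by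
  have h := Submodule.finrank_mono (le_dualCode hC)
  have hN : Module.finrank (ZMod 2) C ≤ N := by simpa using Submodule.finrank_le C
  rw [finrank_dualCode] at h
  omega

open Complex in
theorem one_add_I_pow_two_mul (k : ℕ) : (1 + I) ^ (2 * k) = 2 ^ k * I ^ k := by
  rw [pow_mul, ← mul_pow, show (1 + I) ^ 2 = 2 * I by linear_combination I_sq]

open Complex in
theorem eight_dvd_of_two_mul_finrank_eq (hC : ∀ x ∈ C, 4 ∣ wt x)
    (h : 2 * Module.finrank (ZMod 2) C = N) : 8 ∣ N := by
  have hdual : C = dualCode C :=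
    Submodule.eq_of_le_of_finrank_eq (le_dualCode hC) (by rw [finrank_dualCode]; omega)
  have hsum := sum_dualCode_I_pow_wt hC
  rw [← hdual, sum_code_I_pow_wt hC] at hsum
  generalize Module.finrank (ZMod 2) C = k at h hsum
  rw [← h, one_add_I_pow_two_mul, eq_comm, mul_eq_left₀ (pow_ne_zero k two_ne_zero)] at hsum
  rw [I_pow_eq_pow_mod] at hsum
  have hk : k % 4 < 4 := Nat.mod_lt _ (by norm_num)
  generalize hr : k % 4 = r at hk hsum
  interval_cases r <;> norm_num [Complex.ext_iff, pow_succ] at hsum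
  omega

theorem wt_add_one_eq (x : Fin N → ZMod 2) : wt (x + 1) + wt x = N := by
  have h : ∀ a : ZMod 2, (if a + 1 ≠ 0 then 1 else 0) + (if a ≠ 0 then 1 else 0) = 1 := by decide
  simp only [wt, Finset.card_filter, Pi.add_apply, Pi.one_apply]
  rw [← Finset.sum_add_distrib]
  simp only [h]
  simp

theorem one_mem_dualCode (hC : ∀ x ∈ C, 4 ∣ wt x) : 1 ∈ dualCode C := by
  intro c hc
  have h : c ⬝ᵥ 1 = (wt c : ZMod 2) := by
    have hcases : ∀ a : ZMod 2, a = if a ≠ 0 then 1 else 0 := by decide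
    rw [dotProduct_one, wt, Finset.natCast_card_filter]
    exact Finset.sum_congr rfl fun i _ => hcases (c i)
  change c ⬝ᵥ 1 = 0
  rw [h, ZMod.natCast_eq_zero_iff]
  exact (by norm_num : 2 ∣ 4).trans (hC c hc)

theorem add_self_eq_zero_of_zmod_two (x : Fin N → ZMod 2) : x + x = 0 :=
  funext fun _ => CharTwo.add_self_eq_zero _

theorem mem_dualCode_iff_of_two_mul_finrank_add_one_eq (hC : ∀ x ∈ C, 4 ∣ wt x)
    (h : 2 * Module.finrank (ZMod 2) C + 1 = N) (x : Fin N → ZMod 2) :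
    x ∈ dualCode C ↔ x ∈ C ∨ x + 1 ∈ C := by
  have h1 : (1 : Fin N → ZMod 2) ∉ C := fun h1 => by
    have := hC 1 h1
    have hN := wt_add_one_eq (0 : Fin N → ZMod 2)
    simp only [zero_add] at hN
    have : wt (0 : Fin N → ZMod 2) = 0 := by simp [wt]
    omega
  constructor
  · intro hx
    have hle : C ⊔ Submodule.span (ZMod 2) {1} ≤ dualCode C :=
      sup_le (le_dualCode hC) (by simpa using one_mem_dualCode hC)
    have hlt : C < C ⊔ Submodule.span (ZMod 2) {1} := by
      rw [left_lt_sup]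
      simpa using h1
    have heq : C ⊔ Submodule.span (ZMod 2) {1} = dualCode C := by
      refine Submodule.eq_of_le_of_finrank_le hle ?_
      have := Submodule.finrank_lt_finrank_of_lt hlt
      rw [finrank_dualCode]
      omega
    rw [← heq, Submodule.mem_sup] at hx
    obtain ⟨c, hc, z, hz, rfl⟩ := hx
    obtain ⟨a, rfl⟩ := Submodule.mem_span_singleton.1 hz
    have hcases : ∀ c : ZMod 2, c = 0 ∨ c = 1 := by decide
    rcases hcases a with rfl | rfl
    · left
      simpa using hc
    · right
      rwa [one_smul, add_assoc, add_self_eq_zero_of_zmod_two, add_zero]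
  · rintro (hx | hx)
    · exact le_dualCode hC hx
    · have := (dualCode C).add_mem (le_dualCode hC hx) (one_mem_dualCode hC)
      rwa [add_assoc, add_self_eq_zero_of_zmod_two, add_zero] at this

open Complex in
theorem mod_eight_of_two_mul_finrank_add_one_eq (hC : ∀ x ∈ C, 4 ∣ wt x)
    (h : 2 * Module.finrank (ZMod 2) C + 1 = N) : N % 8 = 1 ∨ N % 8 = 7 := by
  classical
  have hwt : ∀ x ∈ C, I ^ wt (x + 1) = I ^ N := fun x hx => by
    have hN := congrArg (I ^ ·) (wt_add_one_eq x)
    simpa only [pow_add, I_pow_wt_eq_one hC hx, mul_one] using hN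
  have hdisj : ∀ x ∈ C, x + 1 ∉ C := fun x hx hx' => by
    have := hC _ hx
    have := hC _ hx'
    have := wt_add_one_eq x
    omega
  have hsplit : ∀ x : Fin N → ZMod 2, (if x ∈ dualCode C then I ^ wt x else 0) =
      (if x ∈ C then I ^ wt x else 0) + if x + 1 ∈ C then I ^ wt x else 0 := fun x => by
    have := hdisj x
    simp only [mem_dualCode_iff_of_two_mul_finrank_add_one_eq hC h]
    by_cases hx : x ∈ C <;> by_cases hx' : x + 1 ∈ C <;> simp_all
  have hshift : ∑ x : Fin N → ZMod 2, (if x + 1 ∈ C then I ^ wt x else 0) =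
      2 ^ Module.finrank (ZMod 2) C * I ^ N := by
    rw [← sum_code_I_pow_wt hC, Finset.sum_mul,
      ← Equiv.sum_comp (Equiv.addRight (1 : Fin N → ZMod 2))]
    refine Finset.sum_congr rfl fun x _ => ?_
    rw [Equiv.coe_addRight, add_assoc, add_self_eq_zero_of_zmod_two, add_zero]
    split_ifs with hx
    · rw [hwt x hx, I_pow_wt_eq_one hC hx, one_mul]
    · rw [zero_mul]
  have hsum := sum_dualCode_I_pow_wt hC
  simp_rw [hsplit] at hsum
  rw [Finset.sum_add_distrib, sum_code_I_pow_wt hC, hshift] at hsum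
  generalize Module.finrank (ZMod 2) C = k at h hsum
  have hk0 : (2 : ℂ) ^ k ≠ 0 := pow_ne_zero k two_ne_zero
  have hsum' : 1 + I ^ (2 * k + 1) = I ^ k * (1 + I) := by
    refine mul_left_cancel₀ hk0 ?_
    rw [← h, pow_succ (1 + I), one_add_I_pow_two_mul] at hsum
    linear_combination hsum
  rw [pow_succ, mul_comm 2 k, pow_mul, I_pow_eq_pow_mod k] at hsum'
  have hk : k % 4 < 4 := Nat.mod_lt _ (by norm_num)
  generalize hr : k % 4 = r at hk hsum'
  interval_cases r <;> norm_num [Complex.ext_iff, pow_succ] at hsum' <;> omega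

end DoublyEven

/-- The maximum dimension of a doubly even code of length `N = 8m + s` is `4m + t(s)`,
with `t(0)=t(1)=t(2)=t(3)=0`, `t(4)=t(5)=1`, `t(6)=2`, `t(7)=3`. -/
theorem max_doublyEven_dim (N : ℕ) :
    IsGreatest
      {k : ℕ | ∃ C : Submodule (ZMod 2) (Fin N → ZMod 2),
        Module.finrank (ZMod 2) C = k ∧ ∀ x ∈ C, 4 ∣ wt x}
      (4 * (N / 8) + tcorr (N % 8)) := by
  constructor
  · have h := (hasDoublyEven_eight_mul (N / 8)).add
      (hasDoublyEven_tcorr (Nat.mod_lt N (by norm_num : 0 < 8)))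
    rwa [Nat.div_add_mod] at h
  · rintro k ⟨C, rfl, hC⟩
    have hle := two_mul_finrank_le hC
    have heven := eight_dvd_of_two_mul_finrank_eq hC
    have hodd := mod_eight_of_two_mul_finrank_add_one_eq hC
    have hs : N % 8 < 8 := Nat.mod_lt _ (by norm_num)
    generalize hr : N % 8 = s at hs hodd
    interval_cases s <;> simp only [tcorr] <;> omega
end
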